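/- Let P be a POMDP whose goal state G is absorbing (δ(G, a)(G) = 1 for all a ∈ A). (i) If Φ_k is satisfiable for some k ∈ ℕ, say by assignment v, then the memoryless strategy σ defined by letting σ(i) be the uniform distribution on {a ∈ A : v(A_{i,a}) = true} is almost-sure winning for Reach({G}) (in particular a memoryless almost-sure winning strategy exists). (ii) If Φ_k is unsatisfiable for k = |S|, then P has no memoryless almost-sure winning strategy. -/

import Mathlib

open scoped ENNReal
open Filter
open scoped Classical

/-- A POMDP with state space `S`, action alphabet `A`, observations `Z`,
probabilistic transition function, observation function, initial state and goal state. -/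
structure POMDP (S A Z : Type) where
  trans : S → A → PMF S
  obs : S → Z
  init : S
  goal : S

namespace POMDP

variable {S A Z : Type}

/-- A memoryless (observation-stationary) strategy: states with equal observations
get equal distributions over actions. -/
def Memoryless (P : POMDP S A Z) (σ : S → PMF A) : Prop :=
  ∀ s s' : S, P.obs s = P.obs s' → σ s = σ s'

/-- Finite-horizon reach probabilities `p_n` for the goal state under strategy `σ`. -/
noncomputable def preach (P : POMDP S A Z) (σ : S → PMF A) : ℕ → S → ℝ≥0∞
  | 0, s => if s = P.goal then 1 else 0
  | n + 1, s =>
      if s = P.goal then 1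
      else ∑' a : A, σ s a * ∑' s' : S, P.trans s a s' * P.preach σ n s'

/-- `σ` is almost-sure winning for `Reach({G})` iff `p_n(I) → 1`. -/
def AlmostSureWinning (P : POMDP S A Z) (σ : S → PMF A) : Prop :=
  Tendsto (fun n => P.preach σ n P.init) atTop (nhds 1)

/-- A finite path `(s₁, a₁, …, s_{k+1})` (with `k+1` states, `k` transitions)
is compatible with `σ` if each action has positive strategy probability and each
transition has positive transition probability. -/
def IsCompatPath (P : POMDP S A Z) (σ : S → PMF A) (k : ℕ)
    (st : Fin (k + 1) → S) (ac : Fin k → A) : Prop :=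
  ∀ i : Fin k,
    0 < σ (st i.castSucc) (ac i) ∧ 0 < P.trans (st i.castSucc) (ac i) (st i.succ)

/-- `R_σ`: the least set of states containing the initial state and closed under
σ-positive one-step transitions. -/
inductive ReachSet (P : POMDP S A Z) (σ : S → PMF A) : S → Prop
  | init : ReachSet P σ P.init
  | step {s s' : S} (a : A) :
      ReachSet P σ s → 0 < σ s a → 0 < P.trans s a s' → ReachSet P σ s'

end POMDP

/-- A satisfying assignment for the constraint system `Φ_k`: truth values for the
variables `A_{i,a}`, `C_i` and `P_{i,j}` (0 ≤ j ≤ k) satisfying constraints (1)–(7). -/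
def SatPhi {S A Z : Type} (P : POMDP S A Z) (k : ℕ)
    (vA : S → A → Bool) (vC : S → Bool) (vP : S → ℕ → Bool) : Prop :=
  (∀ i : S, ∃ a : A, vA i a = true) ∧
  (∀ i i' : S, P.obs i = P.obs i' → ∀ a : A, (vA i a = true ↔ vA i' a = true)) ∧
  vC P.init = true ∧
  (∀ (i ℓ : S) (a : A), 0 < P.trans i a ℓ →
    vC i = true → vA i a = true → vC ℓ = true) ∧
  (∀ i : S, (vP i 0 = true ↔ i = P.goal)) ∧
  (∀ j : ℕ, j ≤ k → vP P.goal j = true) ∧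
  (∀ i : S, vC i = true → vP i k = true) ∧
  (∀ (i : S) (j : ℕ), 1 ≤ j → j ≤ k →
    (vP i j = true ↔ ∃ a : A, vA i a = true ∧
      ∃ i' : S, 0 < P.trans i a i' ∧ vP i' (j - 1) = true))

namespace POMDP

variable {S A Z : Type}

/-- The probability of not having reached the goal state within `n` steps. -/
noncomputable def loss (P : POMDP S A Z) (σ : S → PMF A) : ℕ → S → ℝ≥0∞
  | 0, s => if s = P.goal then 0 else 1
  | n + 1, s =>
      if s = P.goal then 0
      else ∑' a : A, σ s a * ∑' s' : S, P.trans s a s' * P.loss σ n s'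

lemma preach_goal (P : POMDP S A Z) (σ : S → PMF A) (n : ℕ) : P.preach σ n P.goal = 1 := by
  cases n <;> simp [preach]

lemma loss_goal (P : POMDP S A Z) (σ : S → PMF A) (n : ℕ) : P.loss σ n P.goal = 0 := by
  cases n <;> simp [loss]

lemma loss_add_preach (P : POMDP S A Z) (σ : S → PMF A) (n : ℕ) (s : S) :
    P.loss σ n s + P.preach σ n s = 1 := by
  induction n generalizing s with
  | zero => by_cases h : s = P.goal <;> simp [loss, preach, h]
  | succ n ih =>
    by_cases h : s = P.goal
    · simp [loss, preach, h]
    · simp [loss, preach, h, ← ENNReal.tsum_add, ← mul_add, ih, PMF.tsum_coe]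

lemma loss_le_one (P : POMDP S A Z) (σ : S → PMF A) (n : ℕ) (s : S) : P.loss σ n s ≤ 1 :=
  le_self_add.trans_eq (P.loss_add_preach σ n s)

lemma loss_lt_one_iff (P : POMDP S A Z) (σ : S → PMF A) (n : ℕ) (s : S) :
    P.loss σ n s < 1 ↔ 0 < P.preach σ n s := by
  have h := P.loss_add_preach σ n s
  constructor
  · intro hl
    rw [pos_iff_ne_zero]
    intro h0
    rw [h0, add_zero] at h
    exact hl.ne h
  · intro hp
    refine lt_of_le_of_ne (P.loss_le_one σ n s) fun h1 => hp.ne' ?_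
    rw [h1] at h
    exact (ENNReal.add_right_inj ENNReal.one_ne_top).1 (h.trans (add_zero 1).symm)

lemma tendsto_preach_one_iff (P : POMDP S A Z) (σ : S → PMF A) (s : S) :
    Tendsto (fun n => P.preach σ n s) atTop (nhds 1) ↔
      Tendsto (fun n => P.loss σ n s) atTop (nhds 0) := by
  have hne (n) : P.loss σ n s ≠ ∞ := ((P.loss_le_one σ n s).trans_lt ENNReal.one_lt_top).ne
  have hne' (n) : P.preach σ n s ≠ ∞ :=
    ((le_add_self.trans_eq (P.loss_add_preach σ n s)).trans_lt ENNReal.one_lt_top).ne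
  constructor <;> intro h
  · have := ENNReal.Tendsto.sub (tendsto_const_nhds (x := (1 : ℝ≥0∞)) (f := atTop)) h
      (Or.inl ENNReal.one_ne_top)
    rw [tsub_self] at this
    refine this.congr fun n => ?_
    rw [← P.loss_add_preach σ n s, ENNReal.add_sub_cancel_right (hne' n)]
  · have := ENNReal.Tendsto.sub (tendsto_const_nhds (x := (1 : ℝ≥0∞)) (f := atTop)) h
      (Or.inl ENNReal.one_ne_top)
    rw [tsub_zero] at this
    refine this.congr fun n => ?_
    rw [← P.loss_add_preach σ n s, ENNReal.add_sub_cancel_left (hne n)]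

lemma eq_goal_of_trans_goal_pos (P : POMDP S A Z) (habs : ∀ a : A, P.trans P.goal a P.goal = 1)
    {a : A} {s : S} (h : 0 < P.trans P.goal a s) : s = P.goal := by
  have hs : s ∈ (P.trans P.goal a).support := (PMF.mem_support_iff _ _).2 h.ne'
  rw [(PMF.apply_eq_one_iff _ _).1 (habs a)] at hs
  exact hs

lemma preach_succ_pos_iff (P : POMDP S A Z) (habs : ∀ a : A, P.trans P.goal a P.goal = 1)
    (σ : S → PMF A) (n : ℕ) (s : S) :
    0 < P.preach σ (n + 1) s ↔
      ∃ a : A, 0 < σ s a ∧ ∃ s' : S, 0 < P.trans s a s' ∧ 0 < P.preach σ n s' := by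
  by_cases h : s = P.goal
  · subst h
    obtain ⟨a, ha⟩ := (σ P.goal).support_nonempty
    simp only [preach_goal, zero_lt_one, true_iff]
    exact ⟨a, pos_iff_ne_zero.2 ha, P.goal, by simp [habs], by simp [preach_goal]⟩
  · simp [preach, h, pos_iff_ne_zero, ENNReal.tsum_eq_zero]

/-- Once the loss after `m` steps is at most `c` on a closed set of states, playing `n` further
steps multiplies the `n`-step loss by at most `c`. -/
lemma loss_add_le_mul (P : POMDP S A Z) (σ : S → PMF A) {C : Set S}
    (hC : ∀ s ∈ C, ∀ a s', 0 < σ s a → 0 < P.trans s a s' → s' ∈ C)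
    {m : ℕ} {c : ℝ≥0∞} (hm : ∀ s ∈ C, P.loss σ m s ≤ c) (n : ℕ) :
    ∀ s ∈ C, P.loss σ (m + n) s ≤ c * P.loss σ n s := by
  induction n with
  | zero =>
    intro s hs
    by_cases h : s = P.goal
    · simp [h, loss_goal]
    · simpa [loss, h] using hm s hs
  | succ n ih =>
    intro s hs
    by_cases h : s = P.goal
    · simp [h, loss_goal]
    rw [← add_assoc]
    simp only [loss, h, if_false, ← ENNReal.tsum_mul_left]
    refine ENNReal.tsum_le_tsum fun a => ENNReal.tsum_le_tsum fun s' => ?_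
    rcases eq_or_ne (σ s a) 0 with ha | ha
    · simp [ha]
    rcases eq_or_ne (P.trans s a s') 0 with ht | ht
    · simp [ht]
    calc σ s a * (P.trans s a s' * P.loss σ (m + n) s')
        ≤ σ s a * (P.trans s a s' * (c * P.loss σ n s')) := by
          gcongr
          exact ih s' (hC s hs a s' (pos_iff_ne_zero.2 ha) (pos_iff_ne_zero.2 ht))
      _ = c * (σ s a * (P.trans s a s' * P.loss σ n s')) := by ring

/-- If from every state of a closed set the goal is reached within `k` steps with positive
probability, then it is reached almost surely. -/
lemma tendsto_loss_zero [Fintype S] (P : POMDP S A Z) (σ : S → PMF A) {C : Set S}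
    (hC : ∀ s ∈ C, ∀ a s', 0 < σ s a → 0 < P.trans s a s' → s' ∈ C)
    {k : ℕ} (hk : ∀ s ∈ C, 0 < P.preach σ k s) {s : S} (hs : s ∈ C) :
    Tendsto (fun n => P.loss σ n s) atTop (nhds 0) := by
  obtain ⟨c, hc1, hc⟩ : ∃ c < 1, ∀ s ∈ C, P.loss σ k s ≤ c := by
    refine ⟨(Finset.univ.filter (· ∈ C)).sup (P.loss σ k), ?_, fun s hs =>
      Finset.le_sup (f := P.loss σ k) (by simpa using hs)⟩
    rw [Finset.sup_lt_iff (by simp)]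
    intro s hs
    exact (P.loss_lt_one_iff σ k s).2 (hk s (by simpa using hs))
  have hpow (t : ℕ) : ∀ n, ∀ s ∈ C, P.loss σ (k * t + n) s ≤ c ^ t := by
    induction t with
    | zero => simp [loss_le_one]
    | succ t ih =>
      intro n s hs
      rw [show k * (t + 1) + n = k + (k * t + n) by ring, pow_succ']
      exact (P.loss_add_le_mul σ hC hc _ s hs).trans (mul_le_mul_right (ih n s hs) c)
  rw [ENNReal.tendsto_nhds_zero]
  intro ε hε
  obtain ⟨t, ht⟩ := ((ENNReal.tendsto_nhds_zero.1
    (ENNReal.tendsto_pow_atTop_nhds_zero_of_lt_one hc1)) ε hε).exists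
  filter_upwards [eventually_ge_atTop (k * t)] with n hn
  obtain ⟨r, rfl⟩ := Nat.exists_eq_add_of_le hn
  exact (hpow t r s hs).trans ht

lemma AlmostSureWinning.tendsto_loss {P : POMDP S A Z} {σ : S → PMF A}
    (hσ : P.AlmostSureWinning σ) (habs : ∀ a : A, P.trans P.goal a P.goal = 1)
    {s : S} (hs : P.ReachSet σ s) : Tendsto (fun n => P.loss σ n s) atTop (nhds 0) := by
  induction hs with
  | init => exact (P.tendsto_preach_one_iff σ P.init).1 hσ
  | @step s s' a _ ha ht ih =>
    by_cases h : s = P.goal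
    · subst h
      simp [P.eq_goal_of_trans_goal_pos habs ht, loss_goal]
    have hle (n : ℕ) : P.loss σ n s' ≤ (σ s a * P.trans s a s')⁻¹ * P.loss σ (n + 1) s := by
      rw [mul_comm, ← div_eq_mul_inv, ENNReal.le_div_iff_mul_le
        (Or.inl (ENNReal.mul_pos ha.ne' ht.ne').ne')
        (Or.inl (ENNReal.mul_ne_top (PMF.apply_ne_top _ _) (PMF.apply_ne_top _ _))), mul_comm,
        mul_assoc]
      simp only [loss, h, if_false]
      exact (mul_le_mul_right (ENNReal.le_tsum (f := fun s' => P.trans s a s' * P.loss σ n s') s')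
        (σ s a)).trans
        (ENNReal.le_tsum (f := fun a => σ s a * ∑' s', P.trans s a s' * P.loss σ n s') a)
    refine tendsto_of_tendsto_of_tendsto_of_le_of_le tendsto_const_nhds ?_
      (fun _ => zero_le) hle
    have := ENNReal.Tendsto.const_mul (a := (σ s a * P.trans s a s')⁻¹)
      (ih.comp (tendsto_add_atTop_nat 1))
      (Or.inr (ENNReal.inv_ne_top.2 (ENNReal.mul_pos ha.ne' ht.ne').ne'))
    simpa using this

lemma preach_pos_mono (P : POMDP S A Z) (habs : ∀ a : A, P.trans P.goal a P.goal = 1)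
    (σ : S → PMF A) {m n : ℕ} (hmn : m ≤ n) {s : S} (h : 0 < P.preach σ m s) :
    0 < P.preach σ n s := by
  have hsucc (n : ℕ) : ∀ s, 0 < P.preach σ n s → 0 < P.preach σ (n + 1) s := by
    induction n with
    | zero =>
      intro s h
      have hs : s = P.goal := by
        by_contra hs
        simp [preach, hs] at h
      simp [hs, preach_goal]
    | succ n ih =>
      intro s h
      obtain ⟨a, ha, s', ht, hs'⟩ := (P.preach_succ_pos_iff habs σ n s).1 h
      exact (P.preach_succ_pos_iff habs σ (n + 1) s).2 ⟨a, ha, s', ht, ih s' hs'⟩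
  induction n, hmn using Nat.le_induction with
  | base => exact h
  | succ n _ ih => exact hsucc n s ih

/-- Positivity of the reach probability is decided after `|S|` steps. -/
lemma preach_card_pos [Fintype S] (P : POMDP S A Z)
    (habs : ∀ a : A, P.trans P.goal a P.goal = 1) (σ : S → PMF A) {n : ℕ} {s : S}
    (h : 0 < P.preach σ n s) : 0 < P.preach σ (Fintype.card S) s := by
  let X (n : ℕ) : Finset S := Finset.univ.filter fun s => 0 < P.preach σ n s
  have hmono : Monotone X := fun m n hmn s hs => by
    simp only [X, Finset.mem_filter, Finset.mem_univ, true_and] at hs ⊢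
    exact P.preach_pos_mono habs σ hmn hs
  have hstep (m : ℕ) (hm : X m = X (m + 1)) : X (m + 1) = X (m + 2) := by
    have hm' (s : S) : 0 < P.preach σ m s ↔ 0 < P.preach σ (m + 1) s := by
      simpa [X] using Finset.ext_iff.1 hm s
    ext s
    simp only [X, Finset.mem_filter, Finset.mem_univ, true_and]
    rw [P.preach_succ_pos_iff habs, P.preach_succ_pos_iff habs σ (m + 1)]
    simp only [hm']
  have hcard : (X (max n (Fintype.card S))).card = (X (Fintype.card S)).card :=
    Nat.stabilises_of_monotone (f := fun n => (X n).card)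
      (fun _ _ hmn => Finset.card_le_card (hmono hmn)) (fun _ => Finset.card_le_univ _)
      (fun m hm => congrArg Finset.card
        (hstep m (Finset.eq_of_subset_of_card_le (hmono m.le_succ) hm.ge)))
      (le_max_right _ _)
  have hX := Finset.eq_of_subset_of_card_le (hmono (le_max_right n (Fintype.card S))) hcard.le
  have hs : s ∈ X (Fintype.card S) := hX ▸ hmono (le_max_left n _) (by simpa [X] using h)
  simpa [X] using hs

end POMDP

namespace SatPhi

variable {S A Z : Type} {P : POMDP S A Z} {k : ℕ} {vA : S → A → Bool} {vC : S → Bool}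
  {vP : S → ℕ → Bool}

lemma preach_pos (h : SatPhi P k vA vC vP) (habs : ∀ a : A, P.trans P.goal a P.goal = 1)
    {σ : S → PMF A} (hσ : ∀ s a, vA s a = true → 0 < σ s a) {j : ℕ} (hj : j ≤ k) {s : S}
    (hs : vP s j = true) : 0 < P.preach σ j s := by
  obtain ⟨-, -, -, -, h0, -, -, hstep⟩ := h
  induction j generalizing s with
  | zero => simp [(h0 s).1 hs, POMDP.preach_goal]
  | succ j ih =>
    obtain ⟨a, ha, s', ht, hs'⟩ := (hstep s (j + 1) (by omega) hj).1 hs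
    exact (P.preach_succ_pos_iff habs σ j s).2 ⟨a, hσ s a ha, s', ht, ih (by omega) hs'⟩

lemma almostSureWinning [Fintype S] (h : SatPhi P k vA vC vP)
    (habs : ∀ a : A, P.trans P.goal a P.goal = 1)
    {σ : S → PMF A} (hσ : ∀ s a, 0 < σ s a ↔ vA s a = true) : P.AlmostSureWinning σ := by
  have hpos (s : S) (hs : vC s = true) : 0 < P.preach σ k s :=
    h.preach_pos habs (fun s a => (hσ s a).2) le_rfl (h.2.2.2.2.2.2.1 s hs)
  obtain ⟨-, -, hinit, hclosed, -⟩ := h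
  exact (P.tendsto_preach_one_iff σ P.init).2 <| P.tendsto_loss_zero σ (C := {s | vC s = true})
    (fun s hs a s' ha ht => hclosed s s' a ht hs ((hσ s a).1 ha)) hpos hinit

end SatPhi

lemma POMDP.AlmostSureWinning.exists_satPhi {S A Z : Type} [Fintype S] {P : POMDP S A Z}
    {σ : S → PMF A} (hσ : P.AlmostSureWinning σ)
    (habs : ∀ a : A, P.trans P.goal a P.goal = 1) (hmem : P.Memoryless σ) :
    ∃ (vA : S → A → Bool) (vC : S → Bool) (vP : S → ℕ → Bool),
      SatPhi P (Fintype.card S) vA vC vP := by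
  refine ⟨fun s a => decide (0 < σ s a), fun s => decide (P.ReachSet σ s),
    fun s n => decide (0 < P.preach σ n s), fun s => ?_, fun s s' hs a => ?_, ?_,
    fun s s' a ht hs ha => ?_, fun s => ?_, fun j _ => ?_, fun s hs => ?_, fun s j hj _ => ?_⟩
  · obtain ⟨a, ha⟩ := (σ s).support_nonempty
    exact ⟨a, decide_eq_true (pos_iff_ne_zero.2 ha)⟩
  · simp [hmem s s' hs]
  · exact decide_eq_true .init
  · exact decide_eq_true (.step a (of_decide_eq_true hs) (of_decide_eq_true ha) ht)
  · by_cases h : s = P.goal <;> simp [POMDP.preach, h]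
  · simp [POMDP.preach_goal]
  · obtain ⟨n, hn⟩ := ((hσ.tendsto_loss habs (of_decide_eq_true hs)).eventually_lt_const
      zero_lt_one).exists
    exact decide_eq_true (P.preach_card_pos habs σ ((P.loss_lt_one_iff σ n s).1 hn))
  · obtain ⟨j, rfl⟩ := Nat.exists_eq_add_of_le' hj
    simpa using P.preach_succ_pos_iff habs σ j s

/-- (i) From any satisfying assignment of `Φ_k`, the memoryless strategy playing, in each
state `i`, the uniform distribution on `{a | v(A_{i,a})}` is almost-sure winning (in
particular a memoryless almost-sure winning strategy exists).
(ii) If `Φ_k` with `k = |S|` is unsatisfiable, there is no memoryless almost-sure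
winning strategy. -/
theorem satPhi_sound_and_complete
    {S A Z : Type} [Fintype S] [Nonempty S] [Fintype A] [Nonempty A] [Fintype Z]
    (P : POMDP S A Z) (habs : ∀ a : A, P.trans P.goal a P.goal = 1) :
    (∀ (k : ℕ) (vA : S → A → Bool) (vC : S → Bool) (vP : S → ℕ → Bool),
      SatPhi P k vA vC vP →
        ∃ σ : S → PMF A,
          (∀ (s : S) (a : A), σ s a =
            if vA s a then ((Nat.card {b : A // vA s b = true} : ℝ≥0∞))⁻¹ else 0) ∧
          P.Memoryless σ ∧ P.AlmostSureWinning σ) ∧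
    ((¬ ∃ (vA : S → A → Bool) (vC : S → Bool) (vP : S → ℕ → Bool),
        SatPhi P (Fintype.card S) vA vC vP) →
      ¬ ∃ σ : S → PMF A, P.Memoryless σ ∧ P.AlmostSureWinning σ) := by
  constructor
  · intro k vA vC vP h
    have hne (s : S) : (Finset.univ.filter fun a => vA s a = true).Nonempty := by
      obtain ⟨a, ha⟩ := h.1 s
      exact ⟨a, by simpa using ha⟩
    let σ : S → PMF A := fun s => PMF.uniformOfFinset _ (hne s)
    have hσ (s : S) (a : A) : σ s a =
        if vA s a then ((Nat.card {b : A // vA s b = true} : ℝ≥0∞))⁻¹ else 0 := by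
      simp [σ, PMF.uniformOfFinset_apply, Nat.card_eq_fintype_card, Fintype.card_subtype]
    refine ⟨σ, hσ, fun s s' hs => ?_, h.almostSureWinning habs fun s a => ?_⟩
    · have hA : vA s = vA s' := funext fun a => Bool.eq_iff_iff.2 (h.2.1 s s' hs a)
      ext a
      rw [hσ, hσ, hA]
    · rw [pos_iff_ne_zero, ← PMF.mem_support_iff]
      simp [σ]
  · rintro hunsat ⟨σ, hmem, hwin⟩
    exact hunsat (hwin.exists_satPhi habs hmem)
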